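/- Fix b ∈ ℝ and let L = [[1, 0], [b, 1]] and U = [[1, b], [0, 1]]. For every binary ICA model M = (L, {μ_z^u}_u, {Σ_z^u}_u) with mixing matrix L, there exist mean vectors μ̂_z^u ∈ ℝ² and diagonal positive-definite matrices Σ̂_z^u such that the binary ICA model (U, {μ̂_z^u}_u, {Σ̂_z^u}_u) implies exactly the same probability distribution on the binary observation vector x^u ∈ {0,1}² in every segment u. Hence the causal direction between two variables cannot be detected from binarized observations of the corresponding linear structural equation models. -/

import Mathlib

open MeasureTheory Matrix Real

/-- Multivariate Gaussian measure on `Fin n → ℝ` with mean `μ` and (positive-definite)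
covariance `S`, defined via its density w.r.t. Lebesgue measure. -/
noncomputable def mvGaussian {n : ℕ} (μ : Fin n → ℝ) (S : Matrix (Fin n) (Fin n) ℝ) :
    Measure (Fin n → ℝ) :=
  volume.withDensity fun x =>
    ENNReal.ofReal (Real.sqrt (((2 * Real.pi) ^ n * S.det)⁻¹) *
      Real.exp (-(1 / 2) * ((x - μ) ⬝ᵥ (S⁻¹ *ᵥ (x - μ)))))

/-- The orthant of `ℝ^n` corresponding to a binary assignment `b`:
coordinates with `b i = 1` are negative, the others positive. -/
def orthant {n : ℕ} (b : Fin n → Bool) : Set (Fin n → ℝ) :=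
  {w | ∀ i, if b i then w i < 0 else 0 < w i}

/-- `μ_q = -√(π/8) A μ_z`. -/
noncomputable def muQ {n nz : ℕ} (A : Matrix (Fin n) (Fin nz) ℝ) (μz : Fin nz → ℝ) :
    Fin n → ℝ :=
  (-Real.sqrt (Real.pi / 8)) • (A *ᵥ μz)

/-- `Σ_q = I + (π/8) A Σ_z Aᵀ`. -/
noncomputable def sigmaQ {n nz : ℕ} (A : Matrix (Fin n) (Fin nz) ℝ)
    (Sz : Matrix (Fin nz) (Fin nz) ℝ) : Matrix (Fin n) (Fin n) ℝ :=
  1 + (Real.pi / 8) • (A * Sz * Aᵀ)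

/-- The probability that the binary ICA model with mixing matrix `A`, source means `μz`
and source covariance `Sz` assigns to the binary observation `b`: the probability of the
corresponding orthant under the Gaussian `N(μ_q, Σ_q)`. -/
noncomputable def binProb {n nz : ℕ} (A : Matrix (Fin n) (Fin nz) ℝ) (μz : Fin nz → ℝ)
    (Sz : Matrix (Fin nz) (Fin nz) ℝ) (b : Fin n → Bool) : ENNReal :=
  mvGaussian (muQ A μz) (sigmaQ A Sz) (orthant b)

/-- Correlation matrix of a covariance matrix. -/
noncomputable def corrMat {n : ℕ} (S : Matrix (Fin n) (Fin n) ℝ) :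
    Matrix (Fin n) (Fin n) ℝ :=
  Matrix.of fun i j => S i j / Real.sqrt (S i i * S j j)

/-- The standard normal cumulative distribution function. -/
noncomputable def stdNormalCDF (t : ℝ) : ℝ :=
  ∫ s in Set.Iic t, (Real.sqrt (2 * Real.pi))⁻¹ * Real.exp (-(s ^ 2) / 2)

/-- Positive rescaling of the coordinates preserves every orthant. -/
theorem preimage_diagonal_orthant {n : ℕ} {d : Fin n → ℝ} (hd : ∀ i, 0 < d i)
    (x : Fin n → Bool) :
    (Matrix.toLin' (Matrix.diagonal d)) ⁻¹' orthant x = orthant x := by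
  ext w
  simp only [orthant, Set.mem_preimage, Set.mem_ofPred_eq, Matrix.toLin'_apply,
    Matrix.mulVec_diagonal]
  refine forall_congr' fun i => ?_
  split_ifs
  · exact ⟨fun h => (pos_iff_neg_of_mul_neg h).1 (hd i), mul_neg_of_pos_of_neg (hd i)⟩
  · exact mul_pos_iff_of_pos_left (hd i)

theorem measurableSet_orthant {n : ℕ} (x : Fin n → Bool) : MeasurableSet (orthant x) := by
  simp only [orthant, Set.ofPred_forall]
  refine MeasurableSet.iInter fun i => ?_
  cases x i
  · simpa using measurableSet_lt measurable_const (measurable_pi_apply i)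
  · simpa using measurableSet_lt (measurable_pi_apply i) measurable_const

theorem diagonal_conj_inv_quadratic_form {n : ℕ} {d : Fin n → ℝ} (hd : ∀ i, 0 < d i)
    (S : Matrix (Fin n) (Fin n) ℝ) (z : Fin n → ℝ) :
    (diagonal d *ᵥ z) ⬝ᵥ ((diagonal d * S * diagonal d)⁻¹ *ᵥ (diagonal d *ᵥ z))
      = z ⬝ᵥ (S⁻¹ *ᵥ z) := by
  have hu : IsUnit (diagonal d).det := by
    rw [det_diagonal]
    exact (Finset.prod_pos fun i _ => hd i).ne'.isUnit
  rw [Matrix.mul_inv_rev, Matrix.mul_inv_rev, mulVec_mulVec, Matrix.mul_assoc,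
    Matrix.mul_assoc, Matrix.nonsing_inv_mul _ hu, Matrix.mul_one, ← mulVec_mulVec,
    dotProduct_mulVec, ← mulVec_transpose, transpose_nonsing_inv, diagonal_transpose,
    mulVec_mulVec, Matrix.nonsing_inv_mul _ hu, one_mulVec]

/-- Gaussian orthant probabilities are invariant under positive rescaling of the coordinates. -/
theorem mvGaussian_orthant_diagonal {n : ℕ} {d : Fin n → ℝ} (hd : ∀ i, 0 < d i)
    (μ : Fin n → ℝ) (S : Matrix (Fin n) (Fin n) ℝ) (x : Fin n → Bool) :
    mvGaussian (diagonal d *ᵥ μ) (diagonal d * S * diagonal d) (orthant x)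
      = mvGaussian μ S (orthant x) := by
  have hpos : 0 < (diagonal d).det := by
    rw [det_diagonal]
    exact Finset.prod_pos fun i _ => hd i
  have hvol := Real.smul_map_diagonal_volume_pi hpos.ne'
  have hlin : Measurable (Matrix.toLin' (diagonal d)) :=
    (LinearMap.continuous_of_finiteDimensional _).measurable
  unfold mvGaussian
  rw [withDensity_apply _ (measurableSet_orthant x), withDensity_apply _ (measurableSet_orthant x)]
  conv_lhs => rw [← hvol]
  rw [Measure.restrict_smul, lintegral_smul_measure,
    setLIntegral_map (measurableSet_orthant x) _ hlin, preimage_diagonal_orthant hd,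
    smul_eq_mul, ← lintegral_const_mul']
  · refine lintegral_congr fun w => ?_
    rw [← ENNReal.ofReal_mul (abs_nonneg _), Matrix.toLin'_apply, ← mulVec_sub,
      diagonal_conj_inv_quadratic_form hd, ← mul_assoc]
    congr 2
    have hdet : ((2 * π) ^ n * (diagonal d * S * diagonal d).det)⁻¹
        = ((2 * π) ^ n * S.det)⁻¹ * ((diagonal d).det⁻¹) ^ 2 := by
      rw [det_mul, det_mul, inv_pow, ← mul_inv]
      ring
    rw [hdet, Real.sqrt_mul' _ (sq_nonneg _), Real.sqrt_sq (inv_pos.2 hpos).le,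
      abs_of_pos hpos, mul_left_comm, mul_inv_cancel₀ hpos.ne', mul_one]
  · exact ENNReal.ofReal_ne_top
  · simp only [dotProduct, mulVec]
    fun_prop

/-- Solvability of the equations matching the covariance of the reversed model with a rescaling
of the covariance of the original one. -/
theorem exists_rescaling_reversed_sources (b : ℝ) {c s₁ s₂ : ℝ} (hc : 0 < c) (h₁ : 0 < s₁)
    (h₂ : 0 < s₂) :
    ∃ d₁ d₂ t₁ t₂ : ℝ, 0 < d₁ ∧ 0 < d₂ ∧ 0 < t₁ ∧ 0 < t₂ ∧
      1 + c * (t₁ + b ^ 2 * t₂) = d₁ ^ 2 * (1 + c * s₁) ∧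
      t₂ = d₁ * d₂ * s₁ ∧
      1 + c * t₂ = d₂ ^ 2 * (1 + c * (b ^ 2 * s₁ + s₂)) := by
  obtain ⟨k, hk⟩ : ∃ k, k = c * s₁ := ⟨_, rfl⟩
  obtain ⟨m, hm⟩ : ∃ m, m = c * s₂ := ⟨_, rfl⟩
  have hk0 : 0 < k := hk ▸ mul_pos hc h₁
  have hm0 : 0 < m := hm ▸ mul_pos hc h₂
  obtain ⟨P, hP⟩ : ∃ P, P = 1 + b ^ 2 * k + m := ⟨_, rfl⟩
  have hP0 : 0 < P := by rw [hP]; positivity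
  obtain ⟨v, hv⟩ : ∃ v, v = 1 + (1 + b ^ 2) * k ^ 2 + k ^ 2 := ⟨_, rfl⟩
  have hv1 : 1 ≤ v := by
    have : 0 ≤ (1 + b ^ 2) * k ^ 2 + k ^ 2 := by positivity
    linarith
  have hv0 : 0 < v := by linarith
  obtain ⟨d, hd⟩ : ∃ d, d = √((v + 1) / P) := ⟨_, rfl⟩
  have hd0 : 0 < d := hd ▸ Real.sqrt_pos.2 (by positivity)
  have hd2 : d ^ 2 * P = v + 1 := by
    rw [hd, Real.sq_sqrt (by positivity)]
    field_simp
  obtain ⟨e, he⟩ : ∃ e, e = v / (d * k) := ⟨_, rfl⟩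
  have he0 : 0 < e := he ▸ by positivity
  have hedk : e * d * k = v := by rw [he]; field_simp
  have hpoly : 0 < v ^ 2 * (P * (1 + k) - b ^ 2 * k ^ 2) - v * ((1 + b ^ 2) * k ^ 2) - k ^ 2 := by
    have h1 : P * (1 + k) - b ^ 2 * k ^ 2 = 1 + (k + b ^ 2 * k + m + m * k) := by rw [hP]; ring
    have h2 : 0 < v ^ 2 * (k + b ^ 2 * k + m + m * k) := by positivity
    have h3 : v ^ 2 = v + v * ((1 + b ^ 2) * k ^ 2) + v * k ^ 2 := by
      linear_combination v * hv
    have h4 : k ^ 2 ≤ v * k ^ 2 := le_mul_of_one_le_left (sq_nonneg k) hv1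
    rw [h1, mul_add, mul_one]
    linarith
  have ht : 0 < e ^ 2 * (1 + k) - b ^ 2 * v - 1 := by
    have hscale : (e ^ 2 * (1 + k) - b ^ 2 * v - 1) * (d ^ 2 * k ^ 2 * P)
        = v ^ 2 * (P * (1 + k) - b ^ 2 * k ^ 2) - v * ((1 + b ^ 2) * k ^ 2) - k ^ 2 := by
      have : (e ^ 2 * (1 + k) - b ^ 2 * v - 1) * (d ^ 2 * k ^ 2 * P)
          = (e * d * k) ^ 2 * P * (1 + k) - (b ^ 2 * v + 1) * k ^ 2 * (d ^ 2 * P) := by ring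
      rw [this, hedk, hd2]
      ring
    rw [← hscale] at hpoly
    exact pos_of_mul_pos_left hpoly (by positivity)
  have hcv : c * (e * d * s₁) = v := by rw [← hedk, hk]; ring
  refine ⟨e, d, (e ^ 2 * (1 + k) - b ^ 2 * v - 1) / c, e * d * s₁, he0, hd0, div_pos ht hc,
    by positivity, ?_, rfl, ?_⟩
  · rw [mul_add, mul_div_cancel₀ _ hc.ne', ← hk]
    linear_combination b ^ 2 * hcv
  · rw [hcv]
    linear_combination -hd2 + d ^ 2 * hP + d ^ 2 * b ^ 2 * hk + d ^ 2 * hm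

/-- **Non-identifiability of the causal direction.** For the lower-triangular mixing
matrix `L = [[1,0],[b,1]]` and the upper-triangular `U = [[1,b],[0,1]]` (arising from
the two opposite causal structural equation models), every binary ICA model with mixing
matrix `L` can be matched exactly, in every segment, by a binary ICA model with mixing
matrix `U` after adjusting the source means and (diagonal positive-definite)
covariances. -/
theorem causal_direction_not_identifiable {U : Type*} (b : ℝ)
    (μz : U → Fin 2 → ℝ) (Sz : U → Matrix (Fin 2) (Fin 2) ℝ)
    (hd : ∀ u, (Sz u).IsDiag) (hp : ∀ u, (Sz u).PosDef) :
    ∃ (μz' : U → Fin 2 → ℝ) (Sz' : U → Matrix (Fin 2) (Fin 2) ℝ),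
      (∀ u, (Sz' u).IsDiag) ∧ (∀ u, (Sz' u).PosDef) ∧
      ∀ (u : U) (x : Fin 2 → Bool),
        binProb !![1, b; 0, 1] (μz' u) (Sz' u) x
          = binProb !![1, 0; b, 1] (μz u) (Sz u) x := by
  have key : ∀ u, ∃ (μ' : Fin 2 → ℝ) (S' : Matrix (Fin 2) (Fin 2) ℝ), S'.IsDiag ∧ S'.PosDef ∧
      ∀ x : Fin 2 → Bool, binProb !![1, b; 0, 1] μ' S' x
        = binProb !![1, 0; b, 1] (μz u) (Sz u) x := by
    intro u
    obtain ⟨d₁, d₂, t₁, t₂, hd₁, hd₂, ht₁, ht₂, e₁₁, e₁₂, e₂₂⟩ :=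
      exists_rescaling_reversed_sources b (c := π / 8) (by positivity)
        ((hp u).diag_pos (i := 0)) ((hp u).diag_pos (i := 1))
    have hd' : ∀ i, 0 < ![d₁, d₂] i := by simp [Fin.forall_fin_two, hd₁, hd₂]
    have h01 : Sz u 0 1 = 0 := hd u (by decide)
    have h10 : Sz u 1 0 = 0 := hd u (by decide)
    refine ⟨![d₁ * μz u 0 - b * (d₂ * (b * μz u 0 + μz u 1)), d₂ * (b * μz u 0 + μz u 1)],
      diagonal ![t₁, t₂], isDiag_diagonal _, ?_, fun x => ?_⟩
    · exact PosDef.diagonal (by simp [Fin.forall_fin_two, ht₁, ht₂])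
    · have hμ : muQ !![1, b; 0, 1] ![d₁ * μz u 0 - b * (d₂ * (b * μz u 0 + μz u 1)),
            d₂ * (b * μz u 0 + μz u 1)]
          = diagonal ![d₁, d₂] *ᵥ muQ !![1, 0; b, 1] (μz u) := by
        ext i
        fin_cases i <;>
          simp [muQ, Matrix.mulVec, dotProduct, Fin.sum_univ_two] <;> ring
      have hS : sigmaQ !![1, b; 0, 1] (diagonal ![t₁, t₂])
          = diagonal ![d₁, d₂] * sigmaQ !![1, 0; b, 1] (Sz u) * diagonal ![d₁, d₂] := by
        ext i j
        fin_cases i <;> fin_cases j <;>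
          simp [sigmaQ, Matrix.mul_apply, vecMul, dotProduct, Fin.sum_univ_two, h01, h10, diagonal_apply]
        · linear_combination e₁₁
        · linear_combination π / 8 * b * e₁₂
        · linear_combination π / 8 * b * e₁₂
        · linear_combination e₂₂
      rw [binProb, binProb, hμ, hS, mvGaussian_orthant_diagonal hd']
  choose μ' S' hdiag hpos hprob using key
  exact ⟨μ', S', hdiag, hpos, hprob⟩
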